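/- Let χ be a Dirichlet character modulo N taking only the values -1, 0, 1. Then ∏_{p prime, χ(p) = -1} (1 - p^{-2})^{-1/2} = ∏_{n=1}^{∞} ( (ζ(2^n)/L(2^n, χ)) · ∏_{q prime, χ(q) = 0} (1 - q^{-2^n}) )^{1/2^{n+1}}, where ζ is the Riemann zeta function and L(·, χ) is the Dirichlet L-function of χ. -/

import Mathlib

open Filter Real

/-- The completely multiplicative map `n ↦ χ n * n ^ (-s)` for a real Dirichlet character. -/
noncomputable def realDirichletSummandHom {N : ℕ} (χ : DirichletCharacter ℝ N) {s : ℝ}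
    (hs : s ≠ 0) : ℕ →*₀ ℝ where
  toFun n := χ (n : ZMod N) * (n : ℝ) ^ (-s)
  map_zero' := by simp [hs]
  map_one' := by simp
  map_mul' m n := by
    simp only [Nat.cast_mul, map_mul]
    rw [Real.mul_rpow m.cast_nonneg n.cast_nonneg]
    ring

lemma summable_nat_rpow_neg {s : ℝ} (hs : 1 < s) : Summable fun n : ℕ ↦ (n : ℝ) ^ (-s) :=
  Real.summable_nat_rpow.mpr (by linarith)

lemma prime_rpow_neg_lt_one {p : ℕ} (hp : p.Prime) {s : ℝ} (hs : 0 < s) :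
    (p : ℝ) ^ (-s) < 1 :=
  Real.rpow_lt_one_of_one_lt_of_neg (mod_cast hp.one_lt) (by linarith)

lemma prime_rpow_neg_pos {p : ℕ} (hp : p.Prime) (s : ℝ) : 0 < (p : ℝ) ^ (-s) :=
  Real.rpow_pos_of_pos (mod_cast hp.pos) _

lemma hasProd_realDirichlet {N : ℕ} (χ : DirichletCharacter ℝ N)
    (hχ : ∀ a : ZMod N, |χ a| ≤ 1) {s : ℝ} (hs : 1 < s) :
    HasProd (fun p : Nat.Primes ↦ (1 - χ ((p : ℕ) : ZMod N) * (p : ℝ) ^ (-s))⁻¹)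
      (∑' m : ℕ, χ (m : ZMod N) * (m : ℝ) ^ (-s)) := by
  refine EulerProduct.eulerProduct_completely_multiplicative_hasProd
    (f := realDirichletSummandHom χ (by linarith : s ≠ 0)) ?_
  refine (summable_nat_rpow_neg hs).of_nonneg_of_le (fun _ ↦ norm_nonneg _) fun n ↦ ?_
  change |χ (n : ZMod N) * (n : ℝ) ^ (-s)| ≤ _
  have h0 : (0 : ℝ) ≤ (n : ℝ) ^ (-s) := Real.rpow_nonneg n.cast_nonneg _
  rw [abs_mul, abs_of_nonneg h0]
  exact mul_le_of_le_one_left h0 (hχ _)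

lemma hasProd_realZeta {s : ℝ} (hs : 1 < s) :
    HasProd (fun p : Nat.Primes ↦ (1 - (p : ℝ) ^ (-s))⁻¹) (∑' m : ℕ, (m : ℝ) ^ (-s)) := by
  have h1 (a : ZMod 1) : (1 : DirichletCharacter ℝ 1) a = 1 :=
    MulChar.one_apply (isUnit_of_subsingleton a)
  simpa [h1] using hasProd_realDirichlet (1 : DirichletCharacter ℝ 1) (by simp [h1]) hs

lemma tsum_realDirichlet_ne_zero {N : ℕ} (χ : DirichletCharacter ℝ N)
    (hχ : ∀ a : ZMod N, |χ a| ≤ 1) {s : ℝ} (hs : 1 < s) :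
    (∑' m : ℕ, χ (m : ZMod N) * (m : ℝ) ^ (-s)) ≠ 0 := by
  have hsum : Summable fun p : Nat.Primes ↦ -(χ ((p : ℕ) : ZMod N) * (p : ℝ) ^ (-s)) := by
    refine .neg (.of_norm_bounded ((summable_nat_rpow_neg hs).comp_injective
      Nat.Primes.coe_nat_injective) fun p ↦ ?_)
    have h0 := (prime_rpow_neg_pos p.2 s).le
    rw [Real.norm_eq_abs, abs_mul, abs_of_nonneg h0]
    exact mul_le_of_le_one_left h0 (hχ _)
  have hm := (hasProd_realDirichlet χ hχ hs).mul
    (Real.multipliable_one_add_of_summable hsum).hasProd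
  have h1 : ∀ p : Nat.Primes, (1 - χ ((p : ℕ) : ZMod N) * (p : ℝ) ^ (-s))⁻¹ *
      (1 + -(χ ((p : ℕ) : ZMod N) * (p : ℝ) ^ (-s))) = 1 := fun p ↦ by
    rw [← sub_eq_add_neg]
    refine inv_mul_cancel₀ (sub_ne_zero.mpr fun h ↦ ?_)
    have := mul_le_of_le_one_left (prime_rpow_neg_pos p.2 s).le (le_of_abs_le (hχ (p : ℕ)))
    linarith [prime_rpow_neg_lt_one p.2 (by linarith : 0 < s)]
  simp only [h1] at hm
  intro h
  rw [h, zero_mul] at hm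
  exact one_ne_zero (hasProd_one.unique hm)

lemma summable_log_one_sub_rpow (P : ℕ → Prop) {s : ℝ} (hs : 1 < s) :
    Summable fun p : {p : ℕ // P p} ↦ log (1 - (p.1 : ℝ) ^ (-s)) := by
  simp only [sub_eq_add_neg]
  exact Real.summable_log_one_add_of_summable
    ((summable_nat_rpow_neg hs).comp_injective Subtype.val_injective).neg

lemma one_sub_rpow_neg_pos {p : ℕ} (hp : p.Prime) {s : ℝ} (hs : 1 < s) :
    0 < 1 - (p : ℝ) ^ (-s) := by
  linarith [prime_rpow_neg_lt_one hp (by linarith : 0 < s)]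

/-- The logarithm of the product of `1 - p ^ (-s)` over the primes with `χ p = -1`. -/
noncomputable def logNegPrimeProd {N : ℕ} (χ : DirichletCharacter ℝ N) (s : ℝ) : ℝ :=
  ∑' p : {p : ℕ // p.Prime ∧ χ (p : ZMod N) = -1}, log (1 - (p.1 : ℝ) ^ (-s))

lemma zeta_div_L_mul_eq_exp {N : ℕ} (χ : DirichletCharacter ℝ N)
    (hval : ∀ a : ZMod N, χ a = -1 ∨ χ a = 0 ∨ χ a = 1) {s : ℝ} (hs : 1 < s) :
    (∑' m : ℕ, (m : ℝ) ^ (-s)) / (∑' m : ℕ, χ (m : ZMod N) * (m : ℝ) ^ (-s)) *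
        ∏' q : {q : ℕ // q.Prime ∧ χ (q : ZMod N) = 0}, (1 - (q.1 : ℝ) ^ (-s)) =
      rexp (logNegPrimeProd χ (2 * s) - 2 * logNegPrimeProd χ s) := by
  have hχ (a : ZMod N) : |χ a| ≤ 1 := by rcases hval a with h | h | h <;> simp [h]
  have hs2 : 1 < 2 * s := by linarith
  have hL := hasProd_realDirichlet χ hχ hs
  have hZ := hasProd_realZeta hs
  have hQ : HasProd (fun q : {q : ℕ // q.Prime ∧ χ (q : ZMod N) = 0} ↦ 1 - (q.1 : ℝ) ^ (-s))
      (∏' q : {q : ℕ // q.Prime ∧ χ (q : ZMod N) = 0}, (1 - (q.1 : ℝ) ^ (-s))) :=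
    (Real.multipliable_of_summable_log (fun q ↦ one_sub_rpow_neg_pos q.2.1 hs)
      (summable_log_one_sub_rpow _ hs)).hasProd
  have hA := (((summable_log_one_sub_rpow (fun p ↦ p.Prime ∧ χ (p : ZMod N) = -1)
    hs2).hasSum).sub ((summable_log_one_sub_rpow _ hs).hasSum.mul_left 2)).rexp
  change HasProd _ (rexp (logNegPrimeProd χ (2 * s) - 2 * logNegPrimeProd χ s)) at hA
  have hZ' := (hasProd_subtype_iff_mulIndicator (s := {p : ℕ | p.Prime})
    (f := fun p : ℕ ↦ (1 - (p : ℝ) ^ (-s))⁻¹)).1 hZ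
  have hL' := (hasProd_subtype_iff_mulIndicator (s := {p : ℕ | p.Prime})
    (f := fun p : ℕ ↦ (1 - χ (p : ZMod N) * (p : ℝ) ^ (-s))⁻¹)).1 hL
  have hQ' := (hasProd_subtype_iff_mulIndicator
    (s := {q : ℕ | q.Prime ∧ χ (q : ZMod N) = 0}) (f := fun p : ℕ ↦ 1 - (p : ℝ) ^ (-s))).1 hQ
  have hA' := (hasProd_subtype_iff_mulIndicator
    (s := {p : ℕ | p.Prime ∧ χ (p : ZMod N) = -1})
    (f := fun p : ℕ ↦ rexp (log (1 - (p : ℝ) ^ (-(2 * s))) - 2 * log (1 - (p : ℝ) ^ (-s))))).1 hA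
  have key := (hZ'.mul hQ').unique ((hA'.mul hL').congr fun t ↦ ?_)
  · rw [div_mul_eq_mul_div, div_eq_iff (tsum_realDirichlet_ne_zero χ hχ hs), key]
  refine Finset.prod_congr rfl fun p _ ↦ ?_
  by_cases hp : p.Prime
  swap
  · simp [Set.mulIndicator, hp]
  have hpos := one_sub_rpow_neg_pos hp hs
  have hpos2 := one_sub_rpow_neg_pos hp hs2
  have hsq : (p : ℝ) ^ (-(2 * s)) = ((p : ℝ) ^ (-s)) ^ 2 := by
    rw [← Real.rpow_mul_natCast p.cast_nonneg]
    congr 1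
    push_cast
    ring
  have hexp : rexp (log (1 - (p : ℝ) ^ (-(2 * s))) - 2 * log (1 - (p : ℝ) ^ (-s))) =
      (1 - ((p : ℝ) ^ (-s)) ^ 2) / (1 - (p : ℝ) ^ (-s)) ^ 2 := by
    rw [Real.exp_sub, Real.exp_log hpos2, two_mul (log _), Real.exp_add, Real.exp_log hpos, hsq,
      sq (1 - _)]
  rcases hval (p : ZMod N) with h | h | h
  · simp only [Set.mulIndicator, Set.mem_ofPred_eq, hp, h, true_and, if_true, hexp]
    norm_num
    field_simp
    ring
  · simp [Set.mulIndicator, hp, h, hpos.ne']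
  · simp only [Set.mulIndicator, Set.mem_ofPred_eq, hp, h, true_and, if_true]
    norm_num

lemma logNegPrimeProd_nonpos {N : ℕ} (χ : DirichletCharacter ℝ N) {s : ℝ} (hs : 1 < s) :
    logNegPrimeProd χ s ≤ 0 :=
  tsum_nonpos fun p ↦ Real.log_nonpos (one_sub_rpow_neg_pos p.2.1 hs).le
    (by linarith [prime_rpow_neg_pos p.2.1 s])

lemma logNegPrimeProd_mono {N : ℕ} (χ : DirichletCharacter ℝ N) {s t : ℝ} (hs : 1 < s)
    (hst : s ≤ t) : logNegPrimeProd χ s ≤ logNegPrimeProd χ t := by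
  refine (summable_log_one_sub_rpow _ hs).tsum_le_tsum (fun p ↦ ?_)
    (summable_log_one_sub_rpow _ (hs.trans_le hst))
  refine Real.log_le_log (one_sub_rpow_neg_pos p.2.1 hs) ?_
  have := Real.rpow_le_rpow_of_exponent_le (x := (p.1 : ℝ)) (mod_cast p.2.1.one_le)
    (neg_le_neg hst)
  linarith

theorem stmt14 (N : ℕ) (χ : DirichletCharacter ℝ N)
    (hval : ∀ a : ZMod N, χ a = -1 ∨ χ a = 0 ∨ χ a = 1) :
    ∏' p : {p : ℕ // p.Prime ∧ χ (p : ZMod N) = -1},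
        (1 - (p.1 : ℝ) ^ (-(2 : ℝ))) ^ (-(1 : ℝ) / 2) =
      ∏' n : ℕ,
        ((∑' m : ℕ, (m : ℝ) ^ (-((2 : ℝ) ^ (n + 1)))) /
            (∑' m : ℕ, χ (m : ZMod N) * (m : ℝ) ^ (-((2 : ℝ) ^ (n + 1)))) *
          ∏' q : {q : ℕ // q.Prime ∧ χ (q : ZMod N) = 0},
            (1 - (q.1 : ℝ) ^ (-((2 : ℝ) ^ (n + 1))))) ^ ((1 : ℝ) / 2 ^ (n + 2)) := by
  have hs (n : ℕ) : (1 : ℝ) < 2 ^ (n + 1) := one_lt_pow₀ one_lt_two n.succ_ne_zero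
  set b : ℕ → ℝ := fun n ↦ logNegPrimeProd χ (2 ^ (n + 1)) with hb
  have hb0 (n : ℕ) : b n ≤ 0 := logNegPrimeProd_nonpos χ (hs n)
  have hmono {m n : ℕ} (h : m ≤ n) : b m ≤ b n :=
    logNegPrimeProd_mono χ (hs m) (pow_le_pow_right₀ one_le_two (by lia))
  set c : ℕ → ℝ := fun n ↦ b n / 2 ^ (n + 1) with hc
  have hlhs : HasProd (fun p : {p : ℕ // p.Prime ∧ χ (p : ZMod N) = -1} ↦
      (1 - (p.1 : ℝ) ^ (-(2 : ℝ))) ^ (-(1 : ℝ) / 2)) (rexp (-c 0)) := by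
    have h := ((summable_log_one_sub_rpow (fun p ↦ p.Prime ∧ χ (p : ZMod N) = -1)
      one_lt_two).hasSum.mul_right (-(1 : ℝ) / 2)).rexp
    convert h using 1
    · funext p
      exact Real.rpow_def_of_pos (one_sub_rpow_neg_pos p.2.1 one_lt_two) _
    · simp only [hc, hb, logNegPrimeProd]
      norm_num
      ring
  have hc_lim : Tendsto c atTop (nhds 0) := by
    have h : Tendsto (fun n : ℕ ↦ b 0 * ((1 / 2 : ℝ) ^ (n + 1))) atTop (nhds 0) := by
      simpa using ((tendsto_pow_atTop_nhds_zero_of_lt_one (by norm_num : (0 : ℝ) ≤ 1 / 2)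
        (by norm_num)).comp (tendsto_add_atTop_nat 1)).const_mul (b 0)
    refine tendsto_of_tendsto_of_tendsto_of_le_of_le h tendsto_const_nhds (fun n ↦ ?_)
      fun n ↦ div_nonpos_of_nonpos_of_nonneg (hb0 n) (by positivity)
    simp only [hc, one_div, inv_pow, ← div_eq_mul_inv]
    gcongr
    exact hmono n.zero_le
  have hstep (n : ℕ) : c (n + 1) - c n = (b (n + 1) - 2 * b n) * (1 / 2 ^ (n + 2)) := by
    simp only [hc]
    field_simp
    ring
  have hsum : HasSum (fun n ↦ c (n + 1) - c n) (-c 0) := by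
    rw [hasSum_iff_tendsto_nat_of_nonneg]
    · simp only [Finset.sum_range_sub]
      simpa using hc_lim.sub_const (c 0)
    · intro n
      rw [hstep]
      have := hmono n.le_succ
      exact mul_nonneg (by linarith [hb0 n]) (by positivity)
  rw [hlhs.tprod_eq, ← hsum.rexp.tprod_eq]
  refine tprod_congr fun n ↦ ?_
  rw [zeta_div_L_mul_eq_exp χ hval (hs n), ← pow_succ', ← Real.exp_mul]
  exact congrArg rexp (hstep n)
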